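/- Let φ : ℝ → ℂ be a Schwartz function and A ≥ 1. Then there is a constant C, depending only on A and φ, such that for every integer N ≥ 1, every g : ℤ → ℂ, and every finite set Λ ⊂ ℝ/ℤ that is 1/N-separated (i.e. the distance in ℝ/ℤ between any two distinct points of Λ is at least 1/N), one has ∑_{θ ∈ Λ} |P_N(θ)|² ≤ C · (1/N)·∑_{n∈ℤ} (1 + |n|/N)^{−A}·|g(n)|², where P_N(β) := ∑_{n∈ℤ} (1/N)·φ(n/N)·g(n)·e(nβ) (an inequality in [0,∞]). -/

import Mathlib

open scoped ENNReal NNReal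

/-- `e(t) = exp(2πit)`. -/
noncomputable def expCirc (t : ℝ) : ℂ := Complex.exp (2 * Real.pi * Complex.I * t)

open Finset ComplexConjugate

lemma expCirc_add (s t : ℝ) : expCirc (s + t) = expCirc s * expCirc t := by
  simp only [expCirc, ← Complex.exp_add]
  push_cast
  ring_nf

lemma norm_expCirc (t : ℝ) : ‖expCirc t‖ = 1 := by
  rw [expCirc, show 2 * (Real.pi : ℂ) * Complex.I * t = ((2 * Real.pi * t : ℝ) : ℂ) * Complex.I by
    push_cast; ring]
  exact Complex.norm_exp_ofReal_mul_I _

lemma conj_expCirc (t : ℝ) : conj (expCirc t) = expCirc (-t) := by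
  simp [expCirc, ← Complex.exp_conj, Complex.conj_ofNat]

lemma expCirc_intCast (k : ℤ) : expCirc k = 1 := by
  rw [expCirc, Complex.exp_eq_one_iff]
  exact ⟨k, by push_cast; ring⟩

lemma expCirc_natCast_mul (n : ℕ) (t : ℝ) : expCirc (n * t) = expCirc t ^ n := by
  rw [expCirc, expCirc, ← Complex.exp_nat_mul]
  push_cast
  ring_nf

lemma four_mul_abs_le_norm_expCirc_sub_one {x : ℝ} (hx : |x| ≤ 1 / 2) :
    4 * |x| ≤ ‖expCirc x - 1‖ := by
  have hpi := Real.pi_pos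
  rw [expCirc, show 2 * (Real.pi : ℂ) * Complex.I * x = Complex.I * ((2 * Real.pi * x : ℝ) : ℂ) by
    push_cast; ring, Complex.norm_exp_I_mul_ofReal_sub_one, norm_mul, Real.norm_eq_abs,
    Real.norm_eq_abs, abs_two, show 2 * Real.pi * x / 2 = Real.pi * x by ring]
  have h := Real.mul_abs_le_abs_sin (x := Real.pi * x) (by
    rw [abs_mul, abs_of_pos hpi]; nlinarith)
  rw [abs_mul, abs_of_pos hpi, show 2 / Real.pi * (Real.pi * |x|) = 2 * |x| by field_simp] at h
  linarith

/-- The one-sided Dirichlet kernel `∑_{0 ≤ i < M} e(iβ)`. -/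
noncomputable def dirichletSum (M : ℕ) (β : ℝ) : ℂ := ∑ i ∈ range M, expCirc (i * β)

lemma norm_dirichletSum_le (M : ℕ) (β : ℝ) : ‖dirichletSum M β‖ ≤ M :=
  (norm_sum_le _ _).trans (by simp [norm_expCirc])

lemma conj_dirichletSum (M : ℕ) (β : ℝ) : conj (dirichletSum M β) = dirichletSum M (-β) := by
  simp [dirichletSum, map_sum, conj_expCirc]

lemma norm_dirichletSum_neg (M : ℕ) (β : ℝ) : ‖dirichletSum M (-β)‖ = ‖dirichletSum M β‖ := by
  rw [← conj_dirichletSum, RCLike.norm_conj]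

lemma norm_dirichletSum_mul_le (M : ℕ) (β : ℝ) :
    2 * |β - round β| * ‖dirichletSum M β‖ ≤ 1 := by
  have h1 := four_mul_abs_le_norm_expCirc_sub_one (abs_sub_round β)
  have h2 : expCirc (β - round β) = expCirc β := by
    rw [sub_eq_add_neg, expCirc_add, ← Int.cast_neg, expCirc_intCast, mul_one]
  rw [h2] at h1
  have h3 : (expCirc β - 1) * dirichletSum M β = expCirc β ^ M - 1 := by
    simp only [dirichletSum, expCirc_natCast_mul]
    exact mul_geom_sum _ _
  have h4 : ‖expCirc β ^ M - 1‖ ≤ 2 := by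
    refine (norm_sub_le _ _).trans ?_
    rw [norm_pow, norm_expCirc, one_pow, norm_one]
    norm_num
  rw [← h3, norm_mul] at h4
  nlinarith [norm_nonneg (dirichletSum M β)]

lemma norm_dirichletSum_mul_norm_dirichletSum_le {N : ℕ} (hN : 1 ≤ N) (β : ℝ) :
    ‖dirichletSum (2 * N) β‖ * ‖dirichletSum N β‖ ≤
      4 * (N : ℝ) ^ 2 * (1 / (1 + (⌊(N : ℝ) * (β - round β)⌋ : ℝ) ^ 2)) := by
  set x := β - round β with hx
  set k := ⌊(N : ℝ) * x⌋ with hk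
  have hN' : (1 : ℝ) ≤ N := by exact_mod_cast hN
  have a1 := norm_dirichletSum_le (2 * N) β
  have a2 := norm_dirichletSum_le N β
  have b1 := norm_dirichletSum_mul_le (2 * N) β
  have b2 := norm_dirichletSum_mul_le N β
  rw [← hx] at b1 b2
  push_cast at a1
  set u := ‖dirichletSum (2 * N) β‖
  set v := ‖dirichletSum N β‖
  have hu : 0 ≤ u := norm_nonneg _
  have hv : 0 ≤ v := norm_nonneg _
  have k1 : (k : ℝ) ≤ N * x := Int.floor_le _
  have k2 : (N : ℝ) * x < k + 1 := Int.lt_floor_add_one _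
  rw [mul_one_div, le_div_iff₀ (by positivity)]
  have huv : u * v ≤ 2 * N * N := mul_le_mul a1 a2 hv (by positivity)
  have habs : |(N : ℝ) * x| = N * |x| := by rw [abs_mul, Nat.abs_cast]
  rcases lt_or_ge |(N : ℝ) * x| 1 with h | h
  · obtain ⟨h1, h2⟩ := abs_lt.mp h
    have : (k : ℝ) ^ 2 ≤ 1 := by
      have e1 : (-2 : ℝ) < k := by linarith
      have e2 : (k : ℝ) < 1 := by linarith
      have e1' : (-2 : ℤ) < k := by exact_mod_cast e1
      have e2' : k < 1 := by exact_mod_cast e2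
      have : k = -1 ∨ k = 0 := by omega
      rcases this with h | h <;> rw [h] <;> norm_num
    nlinarith [mul_nonneg hu hv]
  · have hkabs : |(k : ℝ)| ≤ 2 * |(N : ℝ) * x| := by
      rw [abs_le]
      constructor <;> linarith [neg_abs_le ((N : ℝ) * x), le_abs_self ((N : ℝ) * x)]
    have hk2 : 1 + (k : ℝ) ^ 2 ≤ 5 * ((N : ℝ) * |x|) ^ 2 := by
      rw [← habs, ← sq_abs (k : ℝ)]
      nlinarith [abs_nonneg (k : ℝ)]
    have hprod : (2 * |x| * u) * (2 * |x| * v) ≤ 1 :=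
      mul_le_one₀ b1 (by positivity) b2
    calc u * v * (1 + (k : ℝ) ^ 2) ≤ u * v * (5 * ((N : ℝ) * |x|) ^ 2) := by gcongr
      _ = 5 / 4 * (N : ℝ) ^ 2 * ((2 * |x| * u) * (2 * |x| * v)) := by ring
      _ ≤ 5 / 4 * (N : ℝ) ^ 2 * 1 := by gcongr
      _ ≤ _ := by nlinarith

lemma summable_one_div_one_add_intCast_sq : Summable fun k : ℤ ↦ 1 / (1 + (k : ℝ) ^ 2) := by
  refine (Real.summable_one_div_int_pow.mpr one_lt_two).of_norm_bounded_eventually ?_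
  filter_upwards [(Set.finite_singleton (0 : ℤ)).compl_mem_cofinite] with k hk
  have hk' : (0 : ℝ) < (k : ℝ) ^ 2 := by
    have : (k : ℝ) ≠ 0 := by exact_mod_cast hk
    positivity
  rw [Real.norm_of_nonneg (by positivity)]
  exact one_div_le_one_div_of_le hk' (by linarith)

/-- The row sums of the kernel over a separated set are `O(N²)`. -/
lemma sum_norm_dirichletSum_mul_le {N : ℕ} (hN : 1 ≤ N) {Λ : Finset ℝ}
    (hΛ : ∀ θ ∈ Λ, ∀ θ' ∈ Λ, θ ≠ θ' → ∀ k : ℤ, 1 / (N : ℝ) ≤ |θ - θ' - (k : ℝ)|) (α : ℝ) :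
    ∑ θ ∈ Λ, ‖dirichletSum (2 * N) (θ - α)‖ * ‖dirichletSum N (θ - α)‖ ≤
      4 * (N : ℝ) ^ 2 * ∑' k : ℤ, 1 / (1 + (k : ℝ) ^ 2) := by
  have hN0 : (0 : ℝ) < N := by exact_mod_cast hN
  refine (sum_le_sum fun θ _ ↦ norm_dirichletSum_mul_norm_dirichletSum_le hN (θ - α)).trans ?_
  rw [← mul_sum]
  gcongr
  have hinj : Set.InjOn (fun θ : ℝ ↦ ⌊(N : ℝ) * (θ - α - round (θ - α))⌋) Λ := by
    intro θ hθ θ' hθ' h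
    by_contra hne
    have h1 := Int.abs_sub_lt_one_of_floor_eq_floor h
    have h2 := hΛ θ hθ θ' hθ' hne (round (θ - α) - round (θ' - α))
    rw [← mul_sub, abs_mul, Nat.abs_cast] at h1
    rw [div_le_iff₀' hN0] at h2
    refine absurd h1 (not_lt.mpr (h2.trans_eq ?_))
    push_cast
    ring_nf
  rw [← sum_image (f := fun k : ℤ ↦ 1 / (1 + (k : ℝ) ^ 2)) hinj]
  exact summable_one_div_one_add_intCast_sq.sum_le_tsum _ fun _ _ ↦ by positivity

lemma sum_norm_sq_eq_dirichletSum (A B : ℕ) (Λ : Finset ℝ) (c : ℝ → ℂ) :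
    ((∑ i ∈ range A, ∑ j ∈ range B,
        ‖∑ θ ∈ Λ, c θ * expCirc (((i : ℝ) - j) * θ)‖ ^ 2 : ℝ) : ℂ) =
      ∑ θ ∈ Λ, ∑ θ' ∈ Λ, c θ * conj (c θ') *
        (dirichletSum A (θ - θ') * dirichletSum B (-(θ - θ'))) := by
  have hterm (i j : ℕ) : ((‖∑ θ ∈ Λ, c θ * expCirc (((i : ℝ) - j) * θ)‖ ^ 2 : ℝ) : ℂ) =
      ∑ θ ∈ Λ, ∑ θ' ∈ Λ, c θ * conj (c θ') *
        (expCirc (i * (θ - θ')) * expCirc (j * -(θ - θ'))) := by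
    push_cast
    rw [← Complex.mul_conj', map_sum, sum_mul_sum]
    refine sum_congr rfl fun θ _ ↦ sum_congr rfl fun θ' _ ↦ ?_
    rw [map_mul, conj_expCirc, mul_mul_mul_comm, ← expCirc_add, ← expCirc_add]
    ring_nf
  rw [Complex.ofReal_sum]
  simp_rw [Complex.ofReal_sum, hterm, dirichletSum, sum_mul_sum, mul_sum]
  rw [sum_congr rfl fun i _ ↦ sum_comm, sum_comm]
  refine sum_congr rfl fun θ _ ↦ ?_
  rw [sum_congr rfl fun i _ ↦ sum_comm, sum_comm]

/-- Dual large sieve inequality on an interval of length `N`. -/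
lemma sum_range_norm_sq_le {N : ℕ} (hN : 1 ≤ N) {Λ : Finset ℝ}
    (hΛ : ∀ θ ∈ Λ, ∀ θ' ∈ Λ, θ ≠ θ' → ∀ k : ℤ, 1 / (N : ℝ) ≤ |θ - θ' - (k : ℝ)|)
    (c : ℝ → ℂ) :
    ∑ r ∈ range N, ‖∑ θ ∈ Λ, c θ * expCirc (r * θ)‖ ^ 2 ≤
      4 * N * (∑' k : ℤ, 1 / (1 + (k : ℝ) ^ 2)) * ∑ θ ∈ Λ, ‖c θ‖ ^ 2 := by
  have hN0 : (0 : ℝ) < N := by exact_mod_cast hN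
  set W := ∑' k : ℤ, 1 / (1 + (k : ℝ) ^ 2)
  set G : ℝ → ℝ := fun t ↦ ‖∑ θ ∈ Λ, c θ * expCirc (t * θ)‖ ^ 2
  set K : ℝ → ℝ := fun β ↦ ‖dirichletSum (2 * N) β‖ * ‖dirichletSum N β‖
  have hKneg (β : ℝ) : K (-β) = K β := by simp only [K, norm_dirichletSum_neg]
  have hK0 (β : ℝ) : 0 ≤ K β := by positivity
  have hrow (α : ℝ) : ∑ θ ∈ Λ, K (θ - α) ≤ 4 * (N : ℝ) ^ 2 * W :=
    sum_norm_dirichletSum_mul_le hN hΛ α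
  have h1 : N * ∑ r ∈ range N, G r ≤ ∑ i ∈ range (2 * N), ∑ j ∈ range N, G ((i : ℝ) - j) := by
    rw [sum_comm]
    refine (show _ = ∑ _j ∈ range N, ∑ r ∈ range N, G r by simp).trans_le ?_
    refine sum_le_sum fun j hj ↦ ?_
    have : ∑ r ∈ range N, G r = ∑ i ∈ (range N).image (· + j), G ((i : ℝ) - j) := by
      rw [sum_image fun a _ b _ h ↦ by simpa using h]
      simp
    rw [this]
    refine sum_le_sum_of_subset_of_nonneg ?_ fun _ _ _ ↦ by positivity
    intro i hi
    simp only [mem_image, mem_range] at hi hj ⊢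
    omega
  have h2 : ∑ i ∈ range (2 * N), ∑ j ∈ range N, G ((i : ℝ) - j) ≤
      ∑ θ ∈ Λ, ∑ θ' ∈ Λ, ‖c θ‖ * ‖c θ'‖ * K (θ - θ') := by
    refine (le_abs_self _).trans ?_
    rw [← Real.norm_eq_abs, ← Complex.norm_real, sum_norm_sq_eq_dirichletSum]
    refine (norm_sum_le _ _).trans (sum_le_sum fun θ _ ↦ (norm_sum_le _ _).trans
      (sum_le_sum fun θ' _ ↦ ?_))
    simp only [norm_mul, RCLike.norm_conj, norm_dirichletSum_neg, K, le_refl]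
  have h3 : ∑ θ ∈ Λ, ∑ θ' ∈ Λ, ‖c θ‖ * ‖c θ'‖ * K (θ - θ') ≤
      ∑ θ ∈ Λ, ∑ θ' ∈ Λ, (‖c θ‖ ^ 2 / 2 * K (θ' - θ) + ‖c θ'‖ ^ 2 / 2 * K (θ - θ')) := by
    refine sum_le_sum fun θ _ ↦ sum_le_sum fun θ' _ ↦ ?_
    rw [← hKneg (θ' - θ), neg_sub, ← add_mul]
    refine mul_le_mul_of_nonneg_right ?_ (hK0 _)
    nlinarith [sq_nonneg (‖c θ‖ - ‖c θ'‖)]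
  have h4 : ∑ θ ∈ Λ, ∑ θ' ∈ Λ, (‖c θ‖ ^ 2 / 2 * K (θ' - θ) + ‖c θ'‖ ^ 2 / 2 * K (θ - θ')) =
      ∑ θ ∈ Λ, ‖c θ‖ ^ 2 * ∑ θ' ∈ Λ, K (θ' - θ) := by
    simp_rw [sum_add_distrib]
    rw [sum_comm (f := fun θ θ' ↦ ‖c θ'‖ ^ 2 / 2 * K (θ - θ')), ← sum_add_distrib]
    refine sum_congr rfl fun θ _ ↦ ?_
    rw [← mul_sum]
    ring
  have h5 : ∑ θ ∈ Λ, ‖c θ‖ ^ 2 * ∑ θ' ∈ Λ, K (θ' - θ) ≤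
      (4 * (N : ℝ) ^ 2 * W) * ∑ θ ∈ Λ, ‖c θ‖ ^ 2 := by
    rw [mul_sum]
    refine sum_le_sum fun θ _ ↦ ?_
    rw [mul_comm]
    exact mul_le_mul_of_nonneg_right (hrow θ) (by positivity)
  refine le_of_mul_le_mul_left ?_ hN0
  calc N * ∑ r ∈ range N, G r ≤ (4 * (N : ℝ) ^ 2 * W) * ∑ θ ∈ Λ, ‖c θ‖ ^ 2 :=
        h1.trans (h2.trans (h3.trans (h4.trans_le h5)))
    _ = _ := by ring

/-- Dual large sieve inequality with a weight decaying at scale `N`. -/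
lemma sum_weight_norm_sq_le {N : ℕ} (hN : 1 ≤ N) {Λ : Finset ℝ}
    (hΛ : ∀ θ ∈ Λ, ∀ θ' ∈ Λ, θ ≠ θ' → ∀ k : ℤ, 1 / (N : ℝ) ≤ |θ - θ' - (k : ℝ)|)
    (c : ℝ → ℂ) (s : Finset ℤ) :
    ∑ n ∈ s, 1 / (1 + ((n / (N : ℤ) : ℤ) : ℝ) ^ 2) * ‖∑ θ ∈ Λ, c θ * expCirc (n * θ)‖ ^ 2 ≤
      4 * N * (∑' k : ℤ, 1 / (1 + (k : ℝ) ^ 2)) ^ 2 * ∑ θ ∈ Λ, ‖c θ‖ ^ 2 := by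
  have hNz : (0 : ℤ) < N := by exact_mod_cast hN
  set W := ∑' k : ℤ, 1 / (1 + (k : ℝ) ^ 2)
  set G : ℤ → ℝ := fun n ↦ ‖∑ θ ∈ Λ, c θ * expCirc (n * θ)‖ ^ 2
  have hblock (m : ℤ) : ∑ n ∈ s with n / (N : ℤ) = m, G n ≤ 4 * N * W * ∑ θ ∈ Λ, ‖c θ‖ ^ 2 := by
    have h1 := sum_range_norm_sq_le hN hΛ fun θ ↦ c θ * expCirc ((m * N : ℤ) * θ)
    simp only [norm_mul, norm_expCirc, mul_one] at h1
    refine le_trans ?_ h1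
    have h2 : ∑ r ∈ range N,
        ‖∑ θ ∈ Λ, c θ * expCirc ((m * N : ℤ) * θ) * expCirc (r * θ)‖ ^ 2 =
        ∑ n ∈ (range N).image fun r : ℕ ↦ m * N + (r : ℤ), G n := by
      rw [sum_image fun a _ b _ h ↦ by simpa using h]
      refine sum_congr rfl fun r _ ↦ ?_
      simp only [G, mul_assoc, ← expCirc_add]
      push_cast
      simp only [add_mul, mul_assoc]
    rw [h2]
    refine sum_le_sum_of_subset_of_nonneg ?_ fun _ _ _ ↦ by positivity
    intro n hn
    simp only [mem_filter, mem_image, mem_range] at hn ⊢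
    have e1 := Int.emod_nonneg n hNz.ne'
    have e2 := Int.emod_lt_of_pos n hNz
    have e3 := Int.mul_ediv_add_emod n N
    rw [hn.2, mul_comm] at e3
    exact ⟨(n % N).toNat, by omega, by rw [Int.toNat_of_nonneg e1]; exact e3⟩
  rw [← sum_fiberwise_of_maps_to (t := s.image fun n ↦ n / (N : ℤ))
    fun n hn ↦ mem_image_of_mem _ hn]
  calc _ = ∑ m ∈ s.image fun n ↦ n / (N : ℤ),
        1 / (1 + (m : ℝ) ^ 2) * ∑ n ∈ s with n / (N : ℤ) = m, G n := by
        refine sum_congr rfl fun m _ ↦ ?_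
        rw [mul_sum]
        refine sum_congr rfl fun n hn ↦ ?_
        rw [(mem_filter.mp hn).2]
    _ ≤ ∑ m ∈ s.image fun n ↦ n / (N : ℤ),
        1 / (1 + (m : ℝ) ^ 2) * (4 * N * W * ∑ θ ∈ Λ, ‖c θ‖ ^ 2) := by
        gcongr with m
        exact hblock m
    _ = (∑ m ∈ s.image fun n ↦ n / (N : ℤ), 1 / (1 + (m : ℝ) ^ 2)) *
        (4 * N * W * ∑ θ ∈ Λ, ‖c θ‖ ^ 2) := by rw [sum_mul]
    _ ≤ W * (4 * N * W * ∑ θ ∈ Λ, ‖c θ‖ ^ 2) := by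
        have hW : 0 ≤ W := tsum_nonneg fun _ ↦ by positivity
        gcongr
        exact summable_one_div_one_add_intCast_sq.sum_le_tsum _ fun _ _ ↦ by positivity
    _ = _ := by ring

/-- Weighted large sieve inequality for finite trigonometric sums. -/
lemma sum_norm_sq_trigSum_le {N : ℕ} (hN : 1 ≤ N) {Λ : Finset ℝ}
    (hΛ : ∀ θ ∈ Λ, ∀ θ' ∈ Λ, θ ≠ θ' → ∀ k : ℤ, 1 / (N : ℝ) ≤ |θ - θ' - (k : ℝ)|)
    (a : ℤ → ℂ) (s : Finset ℤ) :
    ∑ θ ∈ Λ, ‖∑ n ∈ s, a n * expCirc (n * θ)‖ ^ 2 ≤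
      4 * N * (∑' k : ℤ, 1 / (1 + (k : ℝ) ^ 2)) ^ 2 *
        ∑ n ∈ s, (1 + ((n / (N : ℤ) : ℤ) : ℝ) ^ 2) * ‖a n‖ ^ 2 := by
  set c : ℝ → ℂ := fun θ ↦ conj (∑ n ∈ s, a n * expCirc (n * θ)) with hc
  set X := ∑ θ ∈ Λ, ‖∑ n ∈ s, a n * expCirc (n * θ)‖ ^ 2 with hX
  set D : ℝ := 4 * N * (∑' k : ℤ, 1 / (1 + (k : ℝ) ^ 2)) ^ 2
  set Y := ∑ n ∈ s, (1 + ((n / (N : ℤ) : ℤ) : ℝ) ^ 2) * ‖a n‖ ^ 2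
  have hcX : ∑ θ ∈ Λ, ‖c θ‖ ^ 2 = X := by simp only [hc, hX, RCLike.norm_conj]
  have hX0 : 0 ≤ X := by positivity
  have hY0 : 0 ≤ Y := by positivity
  have hD0 : 0 ≤ D := by positivity
  have hdual : (X : ℂ) = ∑ n ∈ s, a n * ∑ θ ∈ Λ, c θ * expCirc (n * θ) := by
    simp_rw [mul_sum]
    rw [sum_comm, hX]
    push_cast
    refine sum_congr rfl fun θ _ ↦ ?_
    rw [← Complex.conj_mul', mul_sum]
    exact sum_congr rfl fun n _ ↦ by ring
  have hle : X ≤ ∑ n ∈ s, ‖a n‖ * ‖∑ θ ∈ Λ, c θ * expCirc (n * θ)‖ := by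
    refine (le_abs_self _).trans ?_
    rw [← Real.norm_eq_abs, ← Complex.norm_real, hdual]
    exact (norm_sum_le _ _).trans (by simp only [norm_mul, le_refl])
  have hCS : (∑ n ∈ s, ‖a n‖ * ‖∑ θ ∈ Λ, c θ * expCirc (n * θ)‖) ^ 2 ≤ Y * (D * X) := by
    have hw := sum_weight_norm_sq_le hN hΛ c s
    rw [hcX] at hw
    refine le_trans ?_ (mul_le_mul_of_nonneg_left hw hY0)
    refine sum_sq_le_sum_mul_sum_of_sq_le_mul s (fun _ _ ↦ by positivity)
      (fun _ _ ↦ by positivity) fun n _ ↦ le_of_eq ?_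
    have : (1 + ((n / (N : ℤ) : ℤ) : ℝ) ^ 2) ≠ 0 := by positivity
    field_simp
  have hXX : X * X ≤ D * Y * X := by
    calc X * X = X ^ 2 := by ring
      _ ≤ _ := pow_le_pow_left₀ hX0 hle 2
      _ ≤ Y * (D * X) := hCS
      _ = _ := by ring
  rcases hX0.eq_or_lt with h | h
  · rw [← h]; positivity
  · exact le_of_mul_le_mul_right hXX h

lemma SchwartzMap.exists_sq_norm_mul_le (φ : SchwartzMap ℝ ℂ) (A : ℝ) :
    ∃ C : ℝ, 0 ≤ C ∧ ∀ x : ℝ,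
      (1 + (⌊x⌋ : ℝ) ^ 2) * ‖φ x‖ ^ 2 ≤ C * (1 + |x|) ^ (-A) := by
  obtain ⟨k, hk⟩ := exists_nat_ge ((A + 2) / 2)
  set B := 2 ^ k * (Finset.Iic (k, 0)).sup (fun m ↦ SchwartzMap.seminorm ℝ m.1 m.2) φ
  have hB (x : ℝ) : (1 + |x|) ^ k * ‖φ x‖ ≤ B := by
    simpa using SchwartzMap.one_add_le_sup_seminorm_apply (𝕜 := ℝ) (m := (k, 0)) le_rfl le_rfl φ x
  refine ⟨2 * B ^ 2, by positivity, fun x ↦ ?_⟩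
  have hx : (1 : ℝ) ≤ 1 + |x| := by linarith [abs_nonneg x]
  have hx0 : (0 : ℝ) < 1 + |x| := by linarith
  have hfl : |(⌊x⌋ : ℝ)| ≤ 1 + |x| := by
    rw [abs_le]
    constructor <;>
      linarith [Int.floor_le x, Int.lt_floor_add_one x, neg_abs_le x, le_abs_self x]
  have h1 : 1 + (⌊x⌋ : ℝ) ^ 2 ≤ 2 * (1 + |x|) ^ 2 := by
    rw [← sq_abs (⌊x⌋ : ℝ)]
    nlinarith [abs_nonneg (⌊x⌋ : ℝ)]
  have h2 : (1 + |x|) ^ A * (1 + |x|) ^ 2 ≤ ((1 + |x|) ^ k) ^ 2 := by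
    rw [← pow_mul, ← Real.rpow_natCast, ← Real.rpow_natCast, ← Real.rpow_add hx0]
    refine Real.rpow_le_rpow_of_exponent_le hx ?_
    push_cast
    linarith
  rw [Real.rpow_neg hx0.le, ← div_eq_mul_inv, le_div_iff₀ (by positivity)]
  calc (1 + (⌊x⌋ : ℝ) ^ 2) * ‖φ x‖ ^ 2 * (1 + |x|) ^ A
      ≤ 2 * (1 + |x|) ^ 2 * ‖φ x‖ ^ 2 * (1 + |x|) ^ A := by gcongr
    _ = 2 * ((1 + |x|) ^ A * (1 + |x|) ^ 2) * ‖φ x‖ ^ 2 := by ring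
    _ ≤ 2 * ((1 + |x|) ^ k) ^ 2 * ‖φ x‖ ^ 2 := by gcongr
    _ = 2 * ((1 + |x|) ^ k * ‖φ x‖) ^ 2 := by ring
    _ ≤ 2 * B ^ 2 := by
      have := hB x
      gcongr

/-- **Sampling lemma.** Let `φ` be Schwartz and `A ≥ 1`. There is a constant `C` (depending
only on `A` and `φ`) such that for every `N ≥ 1`, every `g : ℤ → ℂ`, and every finite set
`Λ ⊂ ℝ/ℤ` which is `1/N`-separated (here realized as a finite set of reals whose pairwise
distances mod `1` are all `≥ 1/N`), one has
`∑_{θ ∈ Λ} |P_N(θ)|² ≤ C (1/N) ∑_n (1+|n|/N)^{−A} |g(n)|²` (in `[0,∞]`), where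
`P_N(β) = ∑_n (1/N) φ(n/N) g(n) e(nβ)`. -/
theorem sampling_inequality (φ : SchwartzMap ℝ ℂ) (A : ℝ) (hA : 1 ≤ A) :
    ∃ C : ℝ≥0, ∀ N : ℕ, 1 ≤ N → ∀ g : ℤ → ℂ, ∀ Λ : Finset ℝ,
    (∀ θ ∈ Λ, ∀ θ' ∈ Λ, θ ≠ θ' → ∀ k : ℤ, 1 / (N : ℝ) ≤ |θ - θ' - (k : ℝ)|) →
    ∑ θ ∈ Λ, ENNReal.ofReal
        (‖∑' n : ℤ, ((N : ℂ))⁻¹ * φ ((n : ℝ) / N) * g n * expCirc ((n : ℝ) * θ)‖ ^ 2) ≤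
      (C : ℝ≥0∞) * ∑' n : ℤ,
        ENNReal.ofReal ((N : ℝ)⁻¹ * (1 + |(n : ℝ)| / N) ^ (-A) * ‖g n‖ ^ 2) := by
  obtain ⟨C₁, hC₁, hφ⟩ := φ.exists_sq_norm_mul_le A
  set W := ∑' k : ℤ, 1 / (1 + (k : ℝ) ^ 2)
  have hD : 0 ≤ 4 * W ^ 2 * C₁ := by positivity
  refine ⟨(4 * W ^ 2 * C₁).toNNReal, fun N hN g Λ hΛ ↦ ?_⟩
  have hN0 : (0 : ℝ) < N := by exact_mod_cast hN
  set a : ℤ → ℂ := fun n ↦ (N : ℂ)⁻¹ * φ ((n : ℝ) / N) * g n with ha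
  set w : ℤ → ℝ := fun n ↦ (N : ℝ)⁻¹ * (1 + |(n : ℝ)| / N) ^ (-A) * ‖g n‖ ^ 2 with hw
  have hw0 (n : ℤ) : 0 ≤ w n := by positivity
  have hcoeff (n : ℤ) : N * ((1 + ((n / (N : ℤ) : ℤ) : ℝ) ^ 2) * ‖a n‖ ^ 2) ≤ C₁ * w n := by
    have hfloor : ⌊(n : ℝ) / N⌋ = n / (N : ℤ) := by
      rw [Int.floor_div_natCast, Int.floor_intCast]
    have h := hφ ((n : ℝ) / N)
    rw [hfloor, abs_div, Nat.abs_cast] at h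
    calc _ = (N : ℝ)⁻¹ * ((1 + ((n / (N : ℤ) : ℤ) : ℝ) ^ 2) * ‖φ ((n : ℝ) / N)‖ ^ 2) *
          ‖g n‖ ^ 2 := by
          simp only [ha, norm_mul, norm_inv, Complex.norm_natCast]
          field_simp
      _ ≤ (N : ℝ)⁻¹ * (C₁ * (1 + |(n : ℝ)| / N) ^ (-A)) * ‖g n‖ ^ 2 := by gcongr
      _ = _ := by simp only [hw]; ring
  have hfin (s : Finset ℤ) : ∑ θ ∈ Λ, ENNReal.ofReal (‖∑ n ∈ s, a n * expCirc (n * θ)‖ ^ 2) ≤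
      ENNReal.ofReal (4 * W ^ 2 * C₁) * ∑' n : ℤ, ENNReal.ofReal (w n) := by
    rw [← ENNReal.ofReal_sum_of_nonneg fun _ _ ↦ by positivity]
    refine le_trans ?_ (mul_le_mul_right (ENNReal.sum_le_tsum s) _)
    rw [← ENNReal.ofReal_sum_of_nonneg fun n _ ↦ hw0 n, ← ENNReal.ofReal_mul hD]
    refine ENNReal.ofReal_le_ofReal ((sum_norm_sq_trigSum_le hN hΛ a s).trans ?_)
    calc _ = 4 * W ^ 2 * ∑ n ∈ s, N * ((1 + ((n / (N : ℤ) : ℤ) : ℝ) ^ 2) * ‖a n‖ ^ 2) := by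
          rw [← mul_sum]; ring
      _ ≤ 4 * W ^ 2 * ∑ n ∈ s, C₁ * w n := by
          exact mul_le_mul_of_nonneg_left (sum_le_sum fun n _ ↦ hcoeff n) (by positivity)
      _ = _ := by rw [← mul_sum]; ring
  have hsummable (θ : ℝ) : Summable (fun n : ℤ ↦ a n * expCirc (n * θ)) ↔ Summable a := by
    rw [← summable_norm_iff, ← summable_norm_iff (f := a)]
    simp only [norm_mul, norm_expCirc, mul_one]
  by_cases hs : Summable a
  · refine le_of_tendsto' (x := Filter.atTop) (tendsto_finsetSum Λ fun θ _ ↦ ?_) hfin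
    exact ENNReal.tendsto_ofReal ((((hsummable θ).mpr hs).hasSum.norm).pow 2)
  · refine (sum_eq_zero fun θ _ ↦ ?_).trans_le zero_le
    rw [tsum_eq_zero_of_not_summable (mt (hsummable θ).mp hs)]
    simp
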